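/- arXiv:2511.14115 — 2 statements merged into one kernel-verified Lean document; each statement's English description precedes it below -/
import Mathlib

section
/- Let N ≥ 5 be an integer, 2* = 2N/(N−2), and let K1 : (0,∞) → (0,∞) be a bounded function satisfying the (𝕂)-expansion at r0 > 0 with exponent m ∈ [2, N−2); set τ1 = (N−2−m)/(N−2), and fix 0 < γ1 < γ2. Then there exist C > 0 and an integer k0 such that for every integer k ≥ k0, setting μ = k^{1/τ1} and σ_k = k^{1/(N−2)}, for every λ ∈ [γ1, γ2] and every r ∈ [r0 μ − 1, r0 μ + 1] (so that ||x^1| − μ r0| ≤ 1), the function l1(y) = K1(|y|/μ) U_{r,λ}(y)^{2*−1} − Σ_{i=1}^k U_{x^i,λ}(y)^{2*−1} satisfies sup_{y ∈ P_2} |l1(y)| ≤ C μ^{−m}, where P_2 = ⋃_{i=1}^k B_{σ_k²}(x^i). -/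
noncomputable section

/-- (𝕂)-expansion of `K1` at `r0` with exponent `m`. -/
def AssumptionK1 (K1 : ℝ → ℝ) (r0 m : ℝ) : Prop :=
  ∃ c01 θ1 δ C0 : ℝ, 0 < c01 ∧ 0 < θ1 ∧ 0 < δ ∧ 0 < C0 ∧
    ∀ r ∈ Set.Ioo (r0 - δ) (r0 + δ),
      |K1 r - (1 - c01 * |r - r0| ^ m)| ≤ C0 * |r - r0| ^ (m + θ1)

/-- The standard bubble `U_{x,λ}`. -/
noncomputable def bubble (N : ℕ) (x : EuclideanSpace ℝ (Fin N)) (l : ℝ)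
    (y : EuclideanSpace ℝ (Fin N)) : ℝ :=
  ((N : ℝ) * ((N : ℝ) - 2)) ^ (((N : ℝ) - 2) / 4) *
    (l / (1 + l ^ 2 * ‖y - x‖ ^ 2)) ^ (((N : ℝ) - 2) / 2)

/-- The `i`-th of `k` equally spaced points on the circle of radius `r`
in the `(y₁,y₂)`-plane of `ℝ^N` (here `i = 1, …, k`). -/
noncomputable def circlePt (N k : ℕ) (r : ℝ) (i : ℕ) : EuclideanSpace ℝ (Fin N) :=
  WithLp.toLp 2 fun j : Fin N =>
    if (j : ℕ) = 0 then r * Real.cos (2 * Real.pi * ((i : ℝ) - 1) / k)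
    else if (j : ℕ) = 1 then r * Real.sin (2 * Real.pi * ((i : ℝ) - 1) / k)
    else 0

/-- `U_{r,λ} = Σ_{i=1}^k U_{x^i,λ}`. -/
noncomputable def multiBubble (N k : ℕ) (r l : ℝ) (y : EuclideanSpace ℝ (Fin N)) : ℝ :=
  ∑ i ∈ Finset.Icc 1 k, bubble N (circlePt N k r i) l y

lemma bubble_nonneg (N : ℕ) (hN : 2 ≤ N) (x : EuclideanSpace ℝ (Fin N)) {l : ℝ} (hl : 0 ≤ l)
    (y : EuclideanSpace ℝ (Fin N)) : 0 ≤ bubble N x l y := by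
  have hN' : (2 : ℝ) ≤ N := by exact_mod_cast hN
  unfold bubble
  have : (0 : ℝ) ≤ N * ((N : ℝ) - 2) := mul_nonneg (by linarith) (by linarith)
  positivity

/-- Uniform decay of bubbles whose concentration parameter stays in a compact subset
of `(0, ∞)`. -/
lemma exists_bubble_le (N : ℕ) (hN : 2 ≤ N) {γ1 γ2 : ℝ} (hγ1 : 0 < γ1) (hγ : γ1 ≤ γ2) :
    ∃ C : ℝ, 0 < C ∧ ∀ l ∈ Set.Icc γ1 γ2, ∀ x y : EuclideanSpace ℝ (Fin N),
      bubble N x l y ≤ C * ((1 + ‖y - x‖) ^ ((N : ℝ) - 2))⁻¹ := by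
  have hN' : (2 : ℝ) ≤ N := by exact_mod_cast hN
  have hA : (0 : ℝ) ≤ N * ((N : ℝ) - 2) := mul_nonneg (by linarith) (by linarith)
  set A : ℝ := ((N : ℝ) * ((N : ℝ) - 2)) ^ (((N : ℝ) - 2) / 4)
  have hA0 : 0 ≤ A := by positivity
  set b : ℝ := min 1 (γ1 ^ 2)
  have hb : 0 < b := lt_min one_pos (by positivity)
  have hγ2 : 0 < γ2 := hγ1.trans_le hγ
  set B : ℝ := 2 * γ2 / b with hB
  have hB0 : 0 < B := by positivity
  refine ⟨A * B ^ (((N : ℝ) - 2) / 2) + 1, by positivity, fun l hl x y => ?_⟩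
  have hl0 : 0 < l := hγ1.trans_le hl.1
  set d : ℝ := ‖y - x‖
  have hd : 0 ≤ d := norm_nonneg _
  have hbase : l / (1 + l ^ 2 * d ^ 2) ≤ B / (1 + d) ^ 2 := by
    have h1 : b ≤ 1 := min_le_left _ _
    have h2 : b ≤ l ^ 2 := (min_le_right _ _).trans (by gcongr; exact hl.1)
    have h3 : b * (1 + d) ^ 2 ≤ 2 * (1 + l ^ 2 * d ^ 2) := by
      nlinarith [mul_le_mul_of_nonneg_right h2 (sq_nonneg d),
        mul_nonneg hb.le (sq_nonneg (1 - d))]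
    rw [hB, div_div, div_le_div_iff₀ (by positivity) (by positivity)]
    calc l * (b * (1 + d) ^ 2) ≤ γ2 * (2 * (1 + l ^ 2 * d ^ 2)) := by
          gcongr
          exact hl.2
      _ = _ := by ring
  have hpow : (B / (1 + d) ^ 2) ^ (((N : ℝ) - 2) / 2)
      = B ^ (((N : ℝ) - 2) / 2) * ((1 + d) ^ ((N : ℝ) - 2))⁻¹ := by
    rw [Real.div_rpow hB0.le (by positivity), ← Real.rpow_natCast (1 + d) 2,
      ← Real.rpow_mul (by positivity), div_eq_mul_inv]
    congr 3
    push_cast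
    ring
  calc bubble N x l y = A * (l / (1 + l ^ 2 * d ^ 2)) ^ (((N : ℝ) - 2) / 2) := rfl
    _ ≤ A * (B / (1 + d) ^ 2) ^ (((N : ℝ) - 2) / 2) := by
      gcongr
    _ = A * B ^ (((N : ℝ) - 2) / 2) * ((1 + d) ^ ((N : ℝ) - 2))⁻¹ := by rw [hpow]; ring
    _ ≤ _ := by
      gcongr
      linarith

lemma norm_circlePt (N k : ℕ) (hN : 2 ≤ N) {r : ℝ} (hr : 0 ≤ r) (i : ℕ) :
    ‖circlePt N k r i‖ = r := by
  obtain ⟨n, rfl⟩ := Nat.exists_eq_add_of_le' hN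
  have h : ‖circlePt (n + 2) k r i‖ ^ 2 = r ^ 2 := by
    rw [EuclideanSpace.norm_sq_eq]
    simp only [circlePt, Fin.sum_univ_succ, Real.norm_eq_abs, sq_abs]
    simp
    linear_combination r ^ 2 * Real.cos_sq_add_sin_sq (2 * Real.pi * ((i : ℝ) - 1) / k)
  exact (pow_left_inj₀ (norm_nonneg _) hr two_ne_zero).1 h

lemma norm_circlePt_sub (N k : ℕ) (hN : 2 ≤ N) {r : ℝ} (hr : 0 ≤ r) (i j : ℕ) :
    ‖circlePt N k r i - circlePt N k r j‖
      = 2 * r * |Real.sin (Real.pi * ((i : ℝ) - j) / k)| := by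
  obtain ⟨n, rfl⟩ := Nat.exists_eq_add_of_le' hN
  have h : ‖circlePt (n + 2) k r i - circlePt (n + 2) k r j‖ ^ 2
      = (2 * r * |Real.sin (Real.pi * ((i : ℝ) - j) / k)|) ^ 2 := by
    rw [EuclideanSpace.norm_sq_eq]
    simp only [circlePt, Fin.sum_univ_succ, Real.norm_eq_abs, sq_abs, PiLp.sub_apply]
    simp
    set a := 2 * Real.pi * ((i : ℝ) - 1) / k with ha
    set b := 2 * Real.pi * ((j : ℝ) - 1) / k with hb
    have hab : Real.pi * ((i : ℝ) - j) / k = (a - b) / 2 := by rw [ha, hb]; ring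
    rw [hab, mul_pow, sq_abs, Real.sin_sq_eq_half_sub,
      show 2 * ((a - b) / 2) = a - b by ring, Real.cos_sub]
    linear_combination r ^ 2 * Real.cos_sq_add_sin_sq a + r ^ 2 * Real.cos_sq_add_sin_sq b
  exact (pow_left_inj₀ (norm_nonneg _) (by positivity) two_ne_zero).1 h

lemma two_mul_div_le_sin {k s : ℝ} (hk : 0 < k) (hs0 : 0 ≤ s) (hs : s ≤ k / 2) :
    2 * s / k ≤ Real.sin (Real.pi * s / k) := by
  have hpi := Real.pi_pos
  have := Real.mul_le_sin (x := Real.pi * s / k) (by positivity) (by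
    rw [div_le_iff₀ hk]
    nlinarith)
  calc 2 * s / k = 2 / Real.pi * (Real.pi * s / k) := by field_simp
    _ ≤ _ := this

/-- Periodised inverse square weight, dominating the inverse square of the distance of `z`
to the lattice `kℤ` when `|z| < k`. -/
def latticeWeight (k : ℕ) (z : ℤ) : ℝ :=
  1 / (z : ℝ) ^ 2 + 1 / ((z - k : ℤ) : ℝ) ^ 2 + 1 / ((z + k : ℤ) : ℝ) ^ 2

lemma circlePt_separation (N k : ℕ) (hN : 2 ≤ N) {r : ℝ} (hr : 0 ≤ r) {i j : ℕ}
    (hi : i ∈ Finset.Icc 1 k) (hj : j ∈ Finset.Icc 1 k) (hij : i ≠ j) :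
    ∃ s : ℝ, 1 ≤ s ∧ 4 * r * s / k ≤ ‖circlePt N k r i - circlePt N k r j‖ ∧
      1 / s ^ 2 ≤ latticeWeight k ((i : ℤ) - j) := by
  wlog hlt : j < i generalizing i j
  · obtain ⟨s, h1, h2, h3⟩ := this hj hi hij.symm (by omega)
    refine ⟨s, h1, by rwa [norm_sub_rev], h3.trans_eq ?_⟩
    unfold latticeWeight
    push_cast
    have e1 : ((j : ℝ) - i) ^ 2 = (i - j) ^ 2 := by ring
    have e2 : ((j : ℝ) - i - k) ^ 2 = (i - j + k) ^ 2 := by ring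
    have e3 : ((j : ℝ) - i + k) ^ 2 = (i - j - k) ^ 2 := by ring
    rw [e1, e2, e3]
    ring
  rw [Finset.mem_Icc] at hi hj
  have hk : (0 : ℝ) < k := by exact_mod_cast (by omega : 0 < k)
  have h1 : (1 : ℝ) ≤ (i : ℝ) - j := by
    have : (j : ℝ) + 1 ≤ i := by exact_mod_cast hlt
    linarith
  have h2 : (1 : ℝ) ≤ k - ((i : ℝ) - j) := by
    have : (i : ℝ) + 1 ≤ k + j := by exact_mod_cast (by omega : i + 1 ≤ k + j)
    linarith
  rw [norm_circlePt_sub N k hN hr]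
  unfold latticeWeight
  push_cast
  set z : ℝ := (i : ℝ) - j
  have key : ∀ s : ℝ, 2 * s / k ≤ Real.sin (Real.pi * z / k) →
      4 * r * s / k ≤ 2 * r * |Real.sin (Real.pi * z / k)| := fun s hs => by
    calc 4 * r * s / k = 2 * r * (2 * s / k) := by ring
      _ ≤ 2 * r * |Real.sin (Real.pi * z / k)| := by
        gcongr
        exact hs.trans (le_abs_self _)
  rcases le_total z (k / 2) with hz | hz
  · refine ⟨z, h1, key z (two_mul_div_le_sin hk (by linarith) hz), ?_⟩
    have : 0 ≤ 1 / (z - k) ^ 2 := by positivity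
    have : 0 ≤ 1 / (z + k) ^ 2 := by positivity
    linarith
  · refine ⟨k - z, h2, key _ ?_, ?_⟩
    · have := two_mul_div_le_sin (s := k - z) hk (by linarith) (by linarith)
      rwa [show Real.pi * (k - z) / k = Real.pi - Real.pi * z / k by field_simp,
        Real.sin_pi_sub] at this
    · have e : ((k : ℝ) - z) ^ 2 = (z - k) ^ 2 := by ring
      have : 0 ≤ 1 / z ^ 2 := by positivity
      have : 0 ≤ 1 / (z + k) ^ 2 := by positivity
      rw [e]
      linarith

lemma sum_latticeWeight_le (k j : ℕ) (s : Finset ℕ) :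
    ∑ i ∈ s, latticeWeight k ((i : ℤ) - j) ≤ 3 * ∑' z : ℤ, 1 / (z : ℝ) ^ 2 := by
  have hsum : Summable fun z : ℤ => 1 / (z : ℝ) ^ 2 :=
    Real.summable_one_div_int_pow.2 one_lt_two
  have key : ∀ c : ℤ, ∑ i ∈ s, 1 / (((i : ℤ) + c : ℤ) : ℝ) ^ 2
      ≤ ∑' z : ℤ, 1 / (z : ℝ) ^ 2 := fun c => by
    have hinj : Set.InjOn (fun i : ℕ => (i : ℤ) + c) s := fun a _ b _ h => by
      simpa using h
    rw [← Finset.sum_image (g := fun i : ℕ => (i : ℤ) + c)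
      (f := fun z : ℤ => 1 / (z : ℝ) ^ 2) hinj]
    exact hsum.sum_le_tsum _ fun _ _ => by positivity
  have h1 := key (-j)
  have h2 := key (-j - k)
  have h3 := key (-j + k)
  simp only [latticeWeight, Finset.sum_add_distrib]
  have e1 : ∀ i : ℕ, (i : ℤ) - j = i + -j := fun i => by ring
  have e2 : ∀ i : ℕ, (i : ℤ) - j - k = i + (-j - k) := fun i => by ring
  have e3 : ∀ i : ℕ, (i : ℤ) - j + k = i + (-j + k) := fun i => by ring
  simp only [e2, e3]
  simp only [e1]
  linarith

lemma add_rpow_le_rpow_add_mul {a S M q : ℝ} (ha : 0 ≤ a) (hS : 0 ≤ S) (hM : a + S ≤ M)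
    (hq : 1 ≤ q) : (a + S) ^ q ≤ a ^ q + q * M ^ (q - 1) * S := by
  rcases (add_nonneg ha hS).eq_or_lt with h0 | hb
  · have ha0 : a = 0 := by linarith
    have hS0 : S = 0 := by linarith
    simp [ha0, hS0]
  set b := a + S with hb'
  have h := one_add_mul_self_le_rpow_one_add (s := a / b - 1) (p := q)
    (by linarith [div_nonneg ha hb.le]) hq
  rw [add_sub_cancel, Real.div_rpow ha hb.le, le_div_iff₀ (by positivity)] at h
  have hbq : b ^ q = b ^ (q - 1) * b := by
    rw [← Real.rpow_add_one hb.ne', sub_add_cancel]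
  have h2 : (1 + q * (a / b - 1)) * b ^ q = b ^ q - q * b ^ (q - 1) * S := by
    have : a / b - 1 = - S / b := by field_simp; rw [hb']; ring
    rw [this, hbq]
    field_simp
    ring
  rw [h2] at h
  have h3 : q * b ^ (q - 1) * S ≤ q * M ^ (q - 1) * S := by
    gcongr
  linarith

lemma rpow_le_rpow_mul_self {a M q : ℝ} (ha : 0 ≤ a) (hM : a ≤ M) (hq : 1 ≤ q) :
    a ^ q ≤ M ^ (q - 1) * a := by
  rcases ha.eq_or_lt with rfl | ha'
  · simp [Real.zero_rpow (by linarith : q ≠ 0)]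
  · calc a ^ q = a ^ (q - 1) * a := by rw [← Real.rpow_add_one ha'.ne', sub_add_cancel]
      _ ≤ _ := by
        gcongr

/-- The interaction at `y` of all the bubbles but the `j`-th one, for `y` near the `j`-th centre. -/
lemma sum_erase_decay_le (N k : ℕ) (hN : 5 ≤ N) {r R : ℝ} (hr : R / 2 ≤ r) (hR : 0 < R)
    {j : ℕ} (hj : j ∈ Finset.Icc 1 k) {y : EuclideanSpace ℝ (Fin N)}
    (hy : ‖y - circlePt N k r j‖ ≤ R / k) :
    ∑ i ∈ (Finset.Icc 1 k).erase j, ((1 + ‖y - circlePt N k r i‖) ^ ((N : ℝ) - 2))⁻¹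
      ≤ ((R / k) ^ ((N : ℝ) - 2))⁻¹ * (3 * ∑' z : ℤ, 1 / (z : ℝ) ^ 2) := by
  have hN' : (5 : ℝ) ≤ N := by exact_mod_cast hN
  have hk : (0 : ℝ) < k := by
    rw [Finset.mem_Icc] at hj
    exact_mod_cast (by omega : 0 < k)
  have hRk : 0 < R / k := by positivity
  refine le_trans ?_ (mul_le_mul_of_nonneg_left
    (sum_latticeWeight_le k j ((Finset.Icc 1 k).erase j)) (by positivity))
  rw [Finset.mul_sum]
  refine Finset.sum_le_sum fun i hi => ?_
  obtain ⟨hij, hi⟩ := Finset.mem_erase.1 hi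
  obtain ⟨s, hs1, hs2, hs3⟩ :=
    circlePt_separation N k (by omega) (by linarith : 0 ≤ r) hi hj hij
  have hs0 : 0 < s := by linarith
  have hdist : R / k * s ≤ 1 + ‖y - circlePt N k r i‖ := by
    have htri : ‖circlePt N k r i - circlePt N k r j‖
        ≤ ‖y - circlePt N k r j‖ + ‖y - circlePt N k r i‖ := by
      have := norm_sub_le (y - circlePt N k r j) (y - circlePt N k r i)
      rwa [sub_sub_sub_cancel_left] at this
    have h4 : 2 * (R / k * s) ≤ 4 * r * s / k := by
      have : 2 * (R / k * s) = 4 * (R / 2) * s / k := by ring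
      rw [this]
      gcongr
    nlinarith
  calc ((1 + ‖y - circlePt N k r i‖) ^ ((N : ℝ) - 2))⁻¹
      ≤ ((R / k * s) ^ ((N : ℝ) - 2))⁻¹ := by
        gcongr
        linarith
    _ = ((R / k) ^ ((N : ℝ) - 2))⁻¹ * (s ^ ((N : ℝ) - 2))⁻¹ := by
        rw [Real.mul_rpow hRk.le hs0.le, mul_inv]
    _ ≤ ((R / k) ^ ((N : ℝ) - 2))⁻¹ * (1 / s ^ 2) := by
        rw [one_div]
        gcongr
        rw [← Real.rpow_natCast]
        exact Real.rpow_le_rpow_of_exponent_le hs1 (by push_cast; linarith)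
    _ ≤ _ := by gcongr

lemma AssumptionK1.exists_abs_sub_one_le {K1 : ℝ → ℝ} {r0 m : ℝ} (hK : AssumptionK1 K1 r0 m)
    (hm : 0 ≤ m) :
    ∃ C δ : ℝ, 0 < C ∧ 0 < δ ∧ δ ≤ 1 ∧
      ∀ r, |r - r0| < δ → |K1 r - 1| ≤ C * |r - r0| ^ m := by
  obtain ⟨c, θ, δ, C0, hc, hθ, hδ, hC0, h⟩ := hK
  refine ⟨c + C0, min δ 1, by positivity, by positivity, min_le_right _ _, fun r hr => ?_⟩
  have hrδ := abs_lt.1 (hr.trans_le (min_le_left _ _))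
  have h1 : |r - r0| ≤ 1 := hr.le.trans (min_le_right _ _)
  have h2 := h r ⟨by linarith [hrδ.1], by linarith [hrδ.2]⟩
  have h3 : |r - r0| ^ (m + θ) ≤ |r - r0| ^ m :=
    Real.rpow_le_rpow_of_exponent_ge' (abs_nonneg _) h1 hm (by linarith)
  have h4 : 0 ≤ |r - r0| ^ m := by positivity
  rw [show K1 r - 1 = (K1 r - (1 - c * |r - r0| ^ m)) - c * |r - r0| ^ m by ring]
  refine (abs_sub _ _).trans ?_
  rw [abs_of_nonneg (by positivity : 0 ≤ c * |r - r0| ^ m)]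
  nlinarith

/-- The exponents in `μ = k^{1/τ}` and `σ² = k^{2/(N-2)}` make `σ²` negligible with respect to
the spacing `μ / k`. -/
lemma eventually_scales {n m τ : ℝ} (hn : 0 < n) (hm1 : 2 ≤ m) (hm2 : m < n)
    (hτ : τ = (n - m) / n) {ε : ℝ} (hε : 0 < ε) :
    ∀ᶠ k : ℕ in Filter.atTop,
      ((k : ℝ) ^ (1 / n)) ^ (2 : ℕ) ≤ ε * (k : ℝ) ^ (1 / τ) / k ∧
      1 ≤ ε * (k : ℝ) ^ (1 / τ) := by
  have hτ0 : 0 < τ := by rw [hτ]; exact div_pos (by linarith) hn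
  have hexp : 0 < 1 / τ - 1 - 2 / n := by
    have hnm : 0 < n - m := by linarith
    have : 1 / τ - 1 - 2 / n = (m * n - 2 * (n - m)) / ((n - m) * n) := by
      rw [hτ]
      field_simp
      ring
    rw [this]
    exact div_pos (by nlinarith) (by positivity)
  have hlim1 := (tendsto_rpow_atTop hexp).comp (tendsto_natCast_atTop_atTop (R := ℝ))
  have hlim2 := (tendsto_rpow_atTop (one_div_pos.2 hτ0)).comp
    (tendsto_natCast_atTop_atTop (R := ℝ))
  filter_upwards [hlim1.eventually_ge_atTop (1 / ε), hlim2.eventually_ge_atTop (1 / ε),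
    Filter.eventually_ge_atTop 1] with k h1 h2 hk
  have hk : (0 : ℝ) < k := by exact_mod_cast hk
  simp only [Function.comp_apply] at h1 h2
  rw [div_le_iff₀ hε] at h1 h2
  refine ⟨?_, by linarith⟩
  rw [← Real.rpow_natCast, ← Real.rpow_mul hk.le]
  calc (k : ℝ) ^ (1 / n * ((2 : ℕ) : ℝ))
      ≤ (k : ℝ) ^ (1 / n * ((2 : ℕ) : ℝ)) * ((k : ℝ) ^ (1 / τ - 1 - 2 / n) * ε) :=
        le_mul_of_one_le_right (by positivity) h1
    _ = ε * ((k : ℝ) ^ (1 / n * ((2 : ℕ) : ℝ)) * (k : ℝ) ^ (1 / τ - 1 - 2 / n)) := by ring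
    _ = ε * (k : ℝ) ^ (1 / τ) / k := by
        rw [← Real.rpow_add hk, mul_div_assoc, ← Real.rpow_sub_one hk.ne']
        congr 2
        push_cast
        ring

lemma inv_spacing_rpow {n m τ R k : ℝ} (hn : 0 < n) (hm2 : m < n) (hτ : τ = (n - m) / n)
    (hR : 0 < R) (hk : 0 < k) :
    ((R * k ^ (1 / τ) / k) ^ n)⁻¹ = (R ^ n)⁻¹ * (k ^ (1 / τ)) ^ (-m) := by
  have hnm : n - m ≠ 0 := by linarith
  rw [mul_div_assoc, ← Real.rpow_sub_one hk.ne', Real.mul_rpow hR.le (by positivity), mul_inv,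
    ← Real.rpow_neg (by positivity : 0 ≤ k ^ (1 / τ - 1)), ← Real.rpow_mul hk.le,
    ← Real.rpow_mul hk.le]
  congr 2
  rw [hτ]
  field_simp
  ring

/-- Pointwise error estimate in terms of the leading bubble `a = f j` and the remainder. -/
lemma abs_mul_sum_rpow_sub_le {ι : Type*} [DecidableEq ι] {s : Finset ι} {j : ι} (hj : j ∈ s)
    {f : ι → ℝ} (hf : ∀ i ∈ s, 0 ≤ f i) {κ q M : ℝ} (hq : 1 ≤ q) (hM : ∑ i ∈ s, f i ≤ M)
    (hκ : |κ - 1| ≤ 1) :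
    |κ * (∑ i ∈ s, f i) ^ q - ∑ i ∈ s, f i ^ q| ≤
      M ^ (q - 1) * (|κ - 1| * f j) + (2 * q + 1) * M ^ (q - 1) * ∑ i ∈ s.erase j, f i := by
  have hfe : ∀ i ∈ s.erase j, 0 ≤ f i := fun i hi => hf i (Finset.mem_of_mem_erase hi)
  have hle : ∀ i ∈ s, f i ≤ M := fun i hi => (Finset.single_le_sum hf hi).trans hM
  have hM0 : 0 ≤ M := (hf j hj).trans (hle j hj)
  have hsplit := Finset.add_sum_erase s f hj
  have hsplit' := Finset.add_sum_erase s (fun i => f i ^ q) hj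
  set a := f j
  set S := ∑ i ∈ s.erase j, f i with hS
  have ha : 0 ≤ a := hf j hj
  have hS0 : 0 ≤ S := Finset.sum_nonneg hfe
  have hT : ∑ i ∈ s.erase j, f i ^ q ≤ M ^ (q - 1) * S := by
    rw [hS, Finset.mul_sum]
    exact Finset.sum_le_sum fun i hi =>
      rpow_le_rpow_mul_self (hfe i hi) (hle i (Finset.mem_of_mem_erase hi)) hq
  have hT0 : 0 ≤ ∑ i ∈ s.erase j, f i ^ q :=
    Finset.sum_nonneg fun i hi => Real.rpow_nonneg (hfe i hi) _
  rw [← hsplit] at hM ⊢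
  rw [← hsplit']
  set T := ∑ i ∈ s.erase j, f i ^ q
  have hV := add_rpow_le_rpow_add_mul ha hS0 hM hq
  have hV' : a ^ q ≤ (a + S) ^ q := by gcongr; linarith
  have hVa := rpow_le_rpow_mul_self ha (hle j hj) hq
  set V := (a + S) ^ q
  set A := a ^ q
  set P := M ^ (q - 1)
  have hP : 0 ≤ P := by positivity
  have hPS : 0 ≤ q * P * S := by positivity
  have hdecomp : κ * V - (A + T) = (κ - 1) * V + (V - A - T) := by ring
  have h1 : |(κ - 1) * V| ≤ P * (|κ - 1| * a) + q * P * S := by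
    rw [abs_mul, abs_of_nonneg ((Real.rpow_nonneg ha q).trans hV')]
    have hab := abs_nonneg (κ - 1)
    calc |κ - 1| * V ≤ |κ - 1| * (P * a + q * P * S) := by gcongr; linarith
      _ = P * (|κ - 1| * a) + |κ - 1| * (q * P * S) := by ring
      _ ≤ _ := by
        linarith [mul_le_of_le_one_left hPS hκ]
  have h2 : |V - A - T| ≤ q * P * S + P * S := by
    rw [abs_le]
    constructor <;> nlinarith [mul_nonneg hP hS0]
  rw [hdecomp]
  refine (abs_add_le _ _).trans ?_
  nlinarith

/-- Radial deviation, after rescaling by `μ`, of a point at distance `d` from a centre lying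
within distance `1` of the circle of radius `r0 μ`. -/
lemma abs_norm_div_sub_le (N k : ℕ) (hN : 2 ≤ N) {r r0 μ : ℝ} (hμ : 0 < μ) (hr0 : 0 ≤ r)
    (hr : r ∈ Set.Icc (r0 * μ - 1) (r0 * μ + 1)) {j : ℕ} (y : EuclideanSpace ℝ (Fin N)) :
    |‖y‖ / μ - r0| ≤ (1 + ‖y - circlePt N k r j‖) / μ := by
  have h1 : |‖y‖ - r| ≤ ‖y - circlePt N k r j‖ := by
    have := abs_norm_sub_norm_le y (circlePt N k r j)
    rwa [norm_circlePt N k hN hr0] at this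
  have h2 : |r - r0 * μ| ≤ 1 := abs_le.2 ⟨by linarith [hr.1], by linarith [hr.2]⟩
  rw [show ‖y‖ / μ - r0 = (‖y‖ - r0 * μ) / μ by field_simp, abs_div, abs_of_pos hμ]
  gcongr
  linarith [abs_sub_le ‖y‖ r (r0 * μ)]

/-- The decay of a bubble compensates the growth of the weight `x ^ m` for `m ≤ n`. -/
lemma mul_le_of_weight_decay {C C' μ x m n w a : ℝ} (hC : 0 ≤ C) (hC' : 0 ≤ C') (hμ : 0 < μ)
    (hx : 1 ≤ x) (hmn : m ≤ n) (hw : w ≤ C * (x / μ) ^ m) (ha0 : 0 ≤ a)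
    (ha : a ≤ C' * (x ^ n)⁻¹) : w * a ≤ C * C' * μ ^ (-m) := by
  have hx0 : 0 < x := by linarith
  calc w * a ≤ C * (x / μ) ^ m * (C' * (x ^ n)⁻¹) :=
        mul_le_mul hw ha ha0 (by positivity)
    _ = C * C' * μ ^ (-m) * (x ^ m * (x ^ n)⁻¹) := by
        rw [Real.div_rpow hx0.le hμ.le, Real.rpow_neg hμ.le]
        ring
    _ ≤ C * C' * μ ^ (-m) := by
        refine mul_le_of_le_one_right (by positivity) ?_
        rw [← div_eq_mul_inv]
        refine div_le_one_of_le₀ ?_ (by positivity)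
        exact Real.rpow_le_rpow_of_exponent_le hx hmn

/-- Lemma 4.1: the `L^∞(P₂)` bound `‖l₁‖_{L^∞(P₂)} ≤ C μ^{−m}` for the error term
`l₁ = K1(|y|/μ) U_{r,λ}^{2^*−1} − Σ_i U_{x^i,λ}^{2^*−1}` of the approximate solution. -/
theorem approximate_solution_error_sup_bound
    (N : ℕ) (hN : 5 ≤ N)
    (p : ℝ) (hp : p = 2 * N / ((N : ℝ) - 2))
    (K1 : ℝ → ℝ) (hK1pos : ∀ r : ℝ, 0 < r → 0 < K1 r)
    (hK1bdd : ∃ M : ℝ, ∀ r : ℝ, 0 < r → K1 r ≤ M)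
    (r0 m : ℝ) (hr0 : 0 < r0) (hm1 : 2 ≤ m) (hm2 : m < (N : ℝ) - 2)
    (hK : AssumptionK1 K1 r0 m)
    (τ1 : ℝ) (hτ1 : τ1 = ((N : ℝ) - 2 - m) / ((N : ℝ) - 2))
    (γ1 γ2 : ℝ) (hγ1 : 0 < γ1) (hγ12 : γ1 < γ2) :
    ∃ C : ℝ, 0 < C ∧ ∃ k0 : ℕ,
      ∀ k : ℕ, k0 ≤ k →
        ∀ lam ∈ Set.Icc γ1 γ2,
        ∀ r ∈ Set.Icc (r0 * (k : ℝ) ^ (1 / τ1) - 1) (r0 * (k : ℝ) ^ (1 / τ1) + 1),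
        ∀ y ∈ (⋃ i ∈ Finset.Icc 1 k,
            Metric.ball (circlePt N k r i) (((k : ℝ) ^ (1 / ((N : ℝ) - 2))) ^ (2 : ℕ))),
          |K1 (‖y‖ / (k : ℝ) ^ (1 / τ1)) * multiBubble N k r lam y ^ (p - 1) -
              ∑ i ∈ Finset.Icc 1 k, bubble N (circlePt N k r i) lam y ^ (p - 1)| ≤
            C * ((k : ℝ) ^ (1 / τ1)) ^ (-m) := by
  have hN' : (5 : ℝ) ≤ N := by exact_mod_cast hN
  have hn : (0 : ℝ) < (N : ℝ) - 2 := by linarith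
  have hq : 1 ≤ p - 1 := by
    rw [hp, le_sub_iff_add_le, le_div_iff₀ hn]
    linarith
  obtain ⟨CK, δ, hCK, hδ, hδ1, hexpand⟩ := hK.exists_abs_sub_one_le (by linarith)
  obtain ⟨C0, hC0, hbub⟩ := exists_bubble_le N (by omega) hγ1 hγ12.le
  set Z : ℝ := 3 * ∑' z : ℤ, 1 / (z : ℝ) ^ 2 with hZ
  have hZ0 : 0 ≤ Z := mul_nonneg (by norm_num) (tsum_nonneg fun _ => by positivity)
  set C1 : ℝ := C0 * ((r0 ^ ((N : ℝ) - 2))⁻¹ * Z) with hC1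
  have hC10 : 0 ≤ C1 := by positivity
  set M : ℝ := C0 + C1 with hM
  have hM0 : 0 < M := by positivity
  set P : ℝ := M ^ (p - 1 - 1) with hP
  have hP0 : 0 < P := by positivity
  obtain ⟨η, hη0, hηδ, hηK⟩ : ∃ η : ℝ, 0 < η ∧ η < δ ∧ CK * η ≤ 1 := by
    refine ⟨min (δ / 2) (1 / CK), by positivity, (min_le_left _ _).trans_lt (by linarith), ?_⟩
    calc CK * min (δ / 2) (1 / CK) ≤ CK * (1 / CK) := by gcongr; exact min_le_right _ _
      _ = 1 := by field_simp
  obtain ⟨ε, hε0, hεη, hεr⟩ : ∃ ε : ℝ, 0 < ε ∧ ε ≤ η / 2 ∧ ε ≤ r0 / 2 :=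
    ⟨min (η / 2) (r0 / 2), by positivity, min_le_left _ _, min_le_right _ _⟩
  obtain ⟨k1, hk1⟩ := Filter.eventually_atTop.1
    (eventually_scales hn hm1 hm2 hτ1 hε0)
  refine ⟨P * (CK * C0) + (2 * (p - 1) + 1) * P * C1, by positivity, max k1 1, ?_⟩
  intro k hk lam hlam r hr y hy
  obtain ⟨hs, hμ⟩ := hk1 k ((le_max_left _ _).trans hk)
  have hk1' : (1 : ℝ) ≤ k := by exact_mod_cast (le_max_right _ _).trans hk
  have hk0 : (0 : ℝ) < k := by linarith
  have hμ1 : 1 ≤ (k : ℝ) ^ (1 / τ1) := by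
    refine Real.one_le_rpow hk1' (one_div_nonneg.2 ?_)
    rw [hτ1]
    exact div_nonneg (by linarith) hn.le
  have hspace := inv_spacing_rpow hn hm2 hτ1 hr0 hk0
  clear hk1
  set μ : ℝ := (k : ℝ) ^ (1 / τ1)
  clear_value μ
  set σ2 : ℝ := ((k : ℝ) ^ (1 / ((N : ℝ) - 2))) ^ (2 : ℕ)
  have hμ0 : 0 < μ := by linarith
  simp only [Set.mem_iUnion, exists_prop] at hy
  obtain ⟨j, hj, hyj⟩ := hy
  rw [Metric.mem_ball, dist_eq_norm] at hyj
  have hlam0 : 0 ≤ lam := hγ1.le.trans hlam.1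
  have hμr : 1 ≤ r0 * μ / 2 := by nlinarith
  have hr2 : r0 * μ / 2 ≤ r := by linarith [hr.1]
  have hr00 : 0 ≤ r := by linarith
  set d : ℝ := ‖y - circlePt N k r j‖ with hd
  have hd0 : 0 ≤ d := norm_nonneg _
  have hdk : d ≤ r0 * μ / k := by
    refine hyj.le.trans (hs.trans ?_)
    gcongr
    linarith
  have hdε : d ≤ ε * μ := by
    refine hyj.le.trans (hs.trans ?_)
    exact div_le_self (by positivity) hk1'
  have hS : ∑ i ∈ (Finset.Icc 1 k).erase j, bubble N (circlePt N k r i) lam y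
      ≤ C1 * μ ^ (-m) := by
    calc _ ≤ ∑ i ∈ (Finset.Icc 1 k).erase j,
          C0 * ((1 + ‖y - circlePt N k r i‖) ^ ((N : ℝ) - 2))⁻¹ :=
          Finset.sum_le_sum fun i _ => hbub lam hlam _ _
      _ ≤ C0 * (((r0 * μ / k) ^ ((N : ℝ) - 2))⁻¹ * Z) := by
          rw [← Finset.mul_sum]
          gcongr
          exact sum_erase_decay_le N k hN hr2 (by positivity) hj hdk
      _ = C1 * μ ^ (-m) := by
          rw [hspace, hC1]
          ring
  have hμm : μ ^ (-m) ≤ 1 := Real.rpow_le_one_of_one_le_of_nonpos hμ1 (by linarith)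
  have ha := hbub lam hlam (circlePt N k r j) y
  rw [← hd] at ha
  have hd1 : 1 ≤ 1 + d := by linarith
  have haC0 : bubble N (circlePt N k r j) lam y ≤ C0 :=
    ha.trans (mul_le_of_le_one_right hC0.le
      (inv_le_one_of_one_le₀ (Real.one_le_rpow hd1 hn.le)))
  have hsumM : ∑ i ∈ Finset.Icc 1 k, bubble N (circlePt N k r i) lam y ≤ M := by
    rw [← Finset.add_sum_erase _ _ hj]
    have := mul_le_of_le_one_right hC10 hμm
    linarith
  have ht : |‖y‖ / μ - r0| ≤ (1 + d) / μ :=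
    abs_norm_div_sub_le N k (by omega) hμ0 hr00 hr y
  have htη : (1 + d) / μ ≤ η := by
    rw [div_le_iff₀ hμ0]
    nlinarith
  have hκ := hexpand _ ((ht.trans htη).trans_lt hηδ)
  have hκ' : |K1 (‖y‖ / μ) - 1| ≤ CK * ((1 + d) / μ) ^ m :=
    hκ.trans (by gcongr)
  have hκ1 : |K1 (‖y‖ / μ) - 1| ≤ 1 := by
    refine hκ'.trans (le_trans ?_ hηK)
    gcongr
    refine le_trans ?_ htη
    exact Real.rpow_le_self_of_le_one (by positivity) (by linarith) (by linarith)
  have hlead : |K1 (‖y‖ / μ) - 1| * bubble N (circlePt N k r j) lam y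
      ≤ CK * C0 * μ ^ (-m) :=
    mul_le_of_weight_decay hCK.le hC0.le hμ0 hd1 hm2.le hκ'
      (bubble_nonneg N (by omega) _ hlam0 _) ha
  have hmain := abs_mul_sum_rpow_sub_le (κ := K1 (‖y‖ / μ)) hj
    (fun i _ => bubble_nonneg N (by omega) (circlePt N k r i) hlam0 y) hq hsumM hκ1
  unfold multiBubble
  refine hmain.trans ?_
  rw [← hP]
  calc _ ≤ P * (CK * C0 * μ ^ (-m)) + (2 * (p - 1) + 1) * P * (C1 * μ ^ (-m)) :=
        add_le_add (mul_le_mul_of_nonneg_left hlead hP0.le)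
          (mul_le_mul_of_nonneg_left hS (mul_nonneg (by linarith) hP0.le))
    _ = _ := by ring
end
end

section
/- Let N ≥ 5 be an integer, m ∈ [2, N−2), τ1 = (N−2−m)/(N−2), and r0 > 0. Then there exist a constant C > 0 and an integer k0 such that for every integer k ≥ k0, setting μ = k^{1/τ1} and σ_k = k^{1/(N−2)}, for every r ∈ [r0 μ − 1, r0 μ + 1] and the k points x^i = r(cos(2(i−1)π/k), sin(2(i−1)π/k), 0, …, 0) ∈ ℝ² × ℝ^{N−2}, one has Σ_{i=1}^k ∫_{B_{σ_k²}(x^i)} (1 + |y − x^1|)^{−(N−2)} dy ≤ C σ_k^4. -/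
open MeasureTheory

noncomputable section

lemma sum_range_inv_succ_sq_le (n : ℕ) :
    ∑ j ∈ Finset.range n, (((j : ℝ) + 1) ^ 2)⁻¹ ≤ 2 := by
  have h := sum_Ioo_inv_sq_le (α := ℝ) 0 (n + 1)
  rw [← Finset.Ico_add_one_left_eq_Ioo, Finset.sum_Ico_eq_sum_range] at h
  simpa [add_comm] using h

/-- If `k s ≤ r`, the points number `1` and `j + 1` are at distance at least `4 s` times
their cyclic index distance. -/
lemma four_mul_min_le_norm_circlePt_sub (n k j : ℕ) (hk : 0 < k) (hj : j ≤ k) {r s : ℝ}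
    (hs : 0 ≤ s) (hr : k * s ≤ r) :
    4 * s * min (j : ℝ) (k - j) ≤
      ‖circlePt (n + 2) k r (j + 1) - circlePt (n + 2) k r 1‖ := by
  have hk' : (0 : ℝ) < k := by exact_mod_cast hk
  have hjk : (j : ℝ) ≤ k := by exact_mod_cast hj
  have hr0 : 0 ≤ r := le_trans (by positivity) hr
  set x : ℝ := Real.pi * j / k with hx
  have hsin : 2 * min (j : ℝ) (k - j) / k ≤ Real.sin x := by
    rcases le_total (j : ℝ) (k - j) with h | h
    · rw [min_eq_left h]
      have := Real.mul_le_sin (x := x) (by positivity)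
        (by rw [hx, div_le_div_iff₀ hk' two_pos]; nlinarith [Real.pi_pos])
      refine le_trans (le_of_eq ?_) this
      rw [hx]; field_simp
    · rw [min_eq_right h, ← Real.sin_pi_sub]
      have hx' : Real.pi - x = Real.pi * (k - j) / k := by rw [hx]; field_simp
      rw [hx']
      have h0 : (0 : ℝ) ≤ k - j := by linarith
      have := Real.mul_le_sin (x := Real.pi * (k - j) / k) (by positivity)
        (by rw [div_le_div_iff₀ hk' two_pos]; nlinarith [Real.pi_pos])
      refine le_trans (le_of_eq ?_) this
      field_simp
  have hmin : 0 ≤ min (j : ℝ) (k - j) := le_min (by positivity) (by linarith)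
  have hsin0 : 0 ≤ Real.sin x := le_trans (by positivity) hsin
  have hnorm : ‖circlePt (n + 2) k r (j + 1) - circlePt (n + 2) k r 1‖ = 2 * r * Real.sin x := by
    rw [← sq_eq_sq₀ (norm_nonneg _) (by positivity), EuclideanSpace.real_norm_sq_eq,
      Fin.sum_univ_succ, Fin.sum_univ_succ]
    have hang : 2 * Real.pi * j / k = 2 * x := by rw [hx]; ring
    simp [circlePt, hang, Real.cos_two_mul, Real.sin_two_mul]
    linear_combination 4 * r ^ 2 * (Real.cos x ^ 2 - 1) * Real.sin_sq_add_cos_sq x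
  rw [hnorm]
  calc 4 * s * min (j : ℝ) (k - j)
      = 2 * (k * s) * (2 * min (j : ℝ) (k - j) / k) := by field_simp; ring
    _ ≤ 2 * r * Real.sin x := by gcongr

lemma setIntegral_ball_center_le (n : ℕ) (x : EuclideanSpace ℝ (Fin (n + 2))) {s : ℝ}
    (hs : 0 ≤ s) :
    ∫ y in Metric.ball x s, ((1 + ‖y - x‖) ^ n)⁻¹ ≤
      (n + 2) * volume.real (Metric.ball (0 : EuclideanSpace ℝ (Fin (n + 2))) 1) * s ^ 2 := by
  have h1 : ∫ y in Metric.ball x s, ((1 + ‖y - x‖) ^ n)⁻¹ =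
      ∫ y : EuclideanSpace ℝ (Fin (n + 2)),
        (Set.Iio s).indicator (fun t : ℝ => ((1 + t) ^ n)⁻¹) ‖y‖ := by
    rw [← integral_indicator measurableSet_ball, ← integral_add_right_eq_self _ x]
    congr 1
    ext y
    simp [Set.indicator]
  have h2 : ∫ t in Set.Ioi (0 : ℝ),
      t ^ (n + 1) • (Set.Iio s).indicator (fun t : ℝ => ((1 + t) ^ n)⁻¹) t ≤ s ^ 2 := by
    have h3 : ∀ t : ℝ, t ^ (n + 1) • (Set.Iio s).indicator (fun t : ℝ => ((1 + t) ^ n)⁻¹) t =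
        (Set.Iio s).indicator (fun t : ℝ => t ^ (n + 1) * ((1 + t) ^ n)⁻¹) t := by
      intro t
      by_cases h : t < s <;> simp [Set.indicator, h]
    simp_rw [h3]
    rw [setIntegral_indicator measurableSet_Iio, Set.Ioi_inter_Iio]
    refine le_trans (le_abs_self _) ?_
    rw [← Real.norm_eq_abs]
    refine (norm_setIntegral_le_of_norm_le_const (C := s) (by simp) ?_).trans ?_
    · rintro t ⟨ht0, hts⟩
      rw [Real.norm_of_nonneg (by positivity), ← div_eq_mul_inv, div_le_iff₀ (by positivity),
        pow_succ']
      gcongr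
      linarith
    · simp [Real.volume_real_Ioo_of_le hs, sq]
  rw [h1, integral_fun_norm_addHaar volume]
  simp only [finrank_euclideanSpace, Fintype.card_fin, nsmul_eq_mul, smul_eq_mul] at h2 ⊢
  push_cast
  rw [← mul_assoc]
  gcongr

lemma setIntegral_ball_le_of_le_norm_sub (n : ℕ) (x z : EuclideanSpace ℝ (Fin (n + 2)))
    {s l : ℝ} (hs : 0 < s) (hl : 1 ≤ l) (h : 4 * s * l ≤ ‖z - x‖) :
    ∫ y in Metric.ball z s, ((1 + ‖y - x‖) ^ n)⁻¹ ≤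
      volume.real (Metric.ball (0 : EuclideanSpace ℝ (Fin (n + 2))) 1) * s ^ 2 * (l ^ n)⁻¹ := by
  refine le_trans (le_abs_self _) ?_
  rw [← Real.norm_eq_abs]
  refine (norm_setIntegral_le_of_norm_le_const (C := ((s * l) ^ n)⁻¹) measure_ball_lt_top ?_).trans
    (le_of_eq ?_)
  · intro y hy
    rw [mem_ball_iff_norm] at hy
    rw [Real.norm_of_nonneg (by positivity)]
    have h1 : ‖z - x‖ ≤ ‖y - z‖ + ‖y - x‖ := by
      rw [norm_sub_rev y z]; exact norm_sub_le_norm_sub_add_norm_sub z y x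
    gcongr
    nlinarith
  · rw [Measure.real, Measure.addHaar_ball_of_pos volume z hs, ENNReal.toReal_mul,
      ENNReal.toReal_ofReal (by positivity)]
    simp only [finrank_euclideanSpace, Fintype.card_fin, Measure.real]
    rw [mul_pow, pow_add]
    field_simp

lemma inv_min_pow_le {a b : ℝ} (ha : 1 ≤ a) (hb : 1 ≤ b) {n : ℕ} (hn : 2 ≤ n) :
    ((min a b) ^ n)⁻¹ ≤ (a ^ 2)⁻¹ + (b ^ 2)⁻¹ := by
  have h1 : ((min a b) ^ n)⁻¹ ≤ ((min a b) ^ 2)⁻¹ := by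
    have := le_min ha hb
    gcongr
  refine h1.trans ?_
  rcases min_choice a b with h | h <;> rw [h]
  · exact le_add_of_nonneg_right (by positivity)
  · exact le_add_of_nonneg_left (by positivity)

lemma sum_setIntegral_ball_circlePt_le {n k : ℕ} (hn : 2 ≤ n) (hk : 0 < k) {r s : ℝ}
    (hs : 0 < s) (hr : k * s ≤ r) :
    ∑ i ∈ Finset.Icc 1 k, ∫ y in Metric.ball (circlePt (n + 2) k r i) s,
        ((1 + ‖y - circlePt (n + 2) k r 1‖) ^ n)⁻¹ ≤
      (n + 6) * volume.real (Metric.ball (0 : EuclideanSpace ℝ (Fin (n + 2))) 1) * s ^ 2 := by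
  set V := volume.real (Metric.ball (0 : EuclideanSpace ℝ (Fin (n + 2))) 1) with hV
  have hV0 : 0 ≤ V := measureReal_nonneg
  obtain ⟨p, rfl⟩ : ∃ p, k = p + 1 := ⟨k - 1, by omega⟩
  rw [← Finset.Ico_add_one_right_eq_Icc, Finset.sum_Ico_eq_sum_range, Nat.add_sub_cancel,
    Finset.sum_range_succ']
  have hfar : ∀ j ∈ Finset.range p,
      ∫ y in Metric.ball (circlePt (n + 2) (p + 1) r (1 + (j + 1))) s,
        ((1 + ‖y - circlePt (n + 2) (p + 1) r 1‖) ^ n)⁻¹ ≤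
      V * s ^ 2 * ((((j : ℝ) + 1) ^ 2)⁻¹ + ((((p - 1 - j : ℕ) : ℝ) + 1) ^ 2)⁻¹) := by
    intro j hj
    have hj' : j < p := Finset.mem_range.mp hj
    have hcast : (((p + 1 : ℕ) : ℝ) - ((j + 1 : ℕ) : ℝ)) = ((p - 1 - j : ℕ) : ℝ) + 1 := by
      rw [Nat.sub_sub, Nat.cast_sub (by omega)]
      push_cast
      ring
    have hdist := four_mul_min_le_norm_circlePt_sub n (p + 1) (j + 1) hk (by omega) hs.le hr
    rw [hcast, Nat.cast_add, Nat.cast_one] at hdist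
    have ha : (1 : ℝ) ≤ (j : ℝ) + 1 := le_add_of_nonneg_left (Nat.cast_nonneg _)
    have hb : (1 : ℝ) ≤ ((p - 1 - j : ℕ) : ℝ) + 1 := le_add_of_nonneg_left (Nat.cast_nonneg _)
    rw [add_comm 1 (j + 1)]
    refine (setIntegral_ball_le_of_le_norm_sub n _ _ hs (le_min ha hb) hdist).trans ?_
    gcongr
    exact inv_min_pow_le ha hb hn
  have hsum := Finset.sum_le_sum hfar
  rw [← Finset.mul_sum, Finset.sum_add_distrib,
    Finset.sum_range_reflect (fun j : ℕ => (((j : ℝ) + 1) ^ 2)⁻¹) p] at hsum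
  have hnear := setIntegral_ball_center_le n (circlePt (n + 2) (p + 1) r 1) hs.le
  have hV2 : 0 ≤ V * s ^ 2 := by positivity
  rw [← hV] at hnear
  rw [Nat.add_zero]
  nlinarith [mul_le_mul_of_nonneg_left (sum_range_inv_succ_sq_le p) hV2]

lemma eventually_mul_rpow_le {a b r₀ : ℝ} (ha : 0 ≤ a) (hab : 1 + a < b) (hr₀ : 0 < r₀) :
    ∀ᶠ k : ℕ in Filter.atTop, 0 < k ∧ k * (k : ℝ) ^ a ≤ r₀ * (k : ℝ) ^ b - 1 := by
  have h : Filter.Tendsto (fun k : ℕ => (k : ℝ) ^ (b - (1 + a))) Filter.atTop Filter.atTop :=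
    (tendsto_rpow_atTop (sub_pos.mpr hab)).comp tendsto_natCast_atTop_atTop
  filter_upwards [h.eventually_ge_atTop (2 / r₀), Filter.eventually_gt_atTop 0] with k hk1 hk0
  have hk : (1 : ℝ) ≤ k := by exact_mod_cast hk0
  refine ⟨hk0, ?_⟩
  rw [div_le_iff₀ hr₀] at hk1
  have hsplit : (k : ℝ) ^ b = (k : ℝ) ^ (b - (1 + a)) * (k * (k : ℝ) ^ a) := by
    rw [← Real.rpow_one_add' (by positivity) (by positivity), ← Real.rpow_add (by positivity)]
    congr 1
    ring
  have hone : 1 ≤ k * (k : ℝ) ^ a := one_le_mul_of_one_le_of_one_le hk (Real.one_le_rpow hk ha)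
  rw [hsplit]
  nlinarith

/-- Estimate (2.5): the total mass of the weight `(1+|y−x¹|)^{2−N}` over the union of
the balls `B_{σ_k²}(x^i)` is of order `σ_k⁴`. -/
theorem mass_of_weight_over_balls
    (N : ℕ) (hN : 5 ≤ N)
    (m : ℝ) (hm1 : 2 ≤ m) (hm2 : m < (N : ℝ) - 2)
    (τ1 : ℝ) (hτ1 : τ1 = ((N : ℝ) - 2 - m) / ((N : ℝ) - 2))
    (r0 : ℝ) (hr0 : 0 < r0) :
    ∃ C : ℝ, 0 < C ∧ ∃ k0 : ℕ,
      ∀ k : ℕ, k0 ≤ k →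
        ∀ r ∈ Set.Icc (r0 * (k : ℝ) ^ (1 / τ1) - 1) (r0 * (k : ℝ) ^ (1 / τ1) + 1),
          (∑ i ∈ Finset.Icc 1 k,
            ∫ y in Metric.ball (circlePt N k r i)
                (((k : ℝ) ^ (1 / ((N : ℝ) - 2))) ^ (2 : ℕ)),
              (1 + ‖y - circlePt N k r 1‖) ^ (-((N : ℝ) - 2))) ≤
            C * ((k : ℝ) ^ (1 / ((N : ℝ) - 2))) ^ (4 : ℕ) := by
  obtain ⟨n, rfl⟩ : ∃ n, N = n + 2 := ⟨N - 2, by omega⟩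
  have hn : 3 ≤ n := by omega
  have hnR : (3 : ℝ) ≤ n := by exact_mod_cast hn
  have hcast : ((n + 2 : ℕ) : ℝ) - 2 = n := by push_cast; ring
  simp only [hcast] at hm2 hτ1 ⊢
  have hnm : 0 < (n : ℝ) - m := by linarith
  have hexp : 1 + 2 / (n : ℝ) < 1 / τ1 := by
    rw [hτ1, one_div_div, ← sub_pos]
    have : (n : ℝ) / (n - m) - (1 + 2 / n) = (n * (m - 2) + 2 * m) / ((n - m) * n) := by
      field_simp
      ring
    rw [this]
    have : 0 ≤ (n : ℝ) * (m - 2) := mul_nonneg (by linarith) (by linarith)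
    positivity
  obtain ⟨k0, hk0⟩ := Filter.eventually_atTop.mp
    (eventually_mul_rpow_le (by positivity) hexp hr0)
  have hV : 0 < volume.real (Metric.ball (0 : EuclideanSpace ℝ (Fin (n + 2))) 1) :=
    ENNReal.toReal_pos (Metric.measure_ball_pos volume _ one_pos).ne' measure_ball_lt_top.ne
  refine ⟨(n + 6) * volume.real (Metric.ball (0 : EuclideanSpace ℝ (Fin (n + 2))) 1),
    by positivity, k0, fun k hk r hr => ?_⟩
  obtain ⟨hkpos, hle⟩ := hk0 k hk
  have hkR : (0 : ℝ) < k := by exact_mod_cast hkpos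
  have hσ : ((k : ℝ) ^ (1 / (n : ℝ))) ^ 2 = (k : ℝ) ^ (2 / (n : ℝ)) := by
    rw [← Real.rpow_mul_natCast hkR.le]
    congr 1
    push_cast
    ring
  have hmain := sum_setIntegral_ball_circlePt_le (n := n) (by omega) hkpos
    (Real.rpow_pos_of_pos hkR (2 / (n : ℝ))) (hle.trans hr.1)
  rw [← hσ, ← pow_mul] at hmain
  refine le_trans (le_of_eq ?_) hmain
  refine Finset.sum_congr rfl fun i _ => integral_congr_ae (.of_forall fun y => ?_)
  simp only
  rw [Real.rpow_neg (by positivity), Real.rpow_natCast]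
end
end
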